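/- arXiv:1112.5138 — 3 statements merged into one kernel-verified Lean document; each statement's English description precedes it below -/
import Mathlib

section
/- Let Ω ⊂ ℂⁿ be a bounded domain with smooth boundary which is pseudoconvex. Then there exists an open neighborhood U of bΩ such that the function z ↦ -log(-δ(z)) is plurisubharmonic on U ∩ Ω, i.e. its complex Hessian is nonnegative-definite at every point of U ∩ Ω in every direction V ∈ ℂⁿ. -/
noncomputable section

open Complex Metric Set
open scoped Classical RealInnerProductSpace

/-- Signed distance to the boundary of `Ω`: negative inside `Ω`, positive outside. -/
def sdist {n : ℕ} (Ω : Set (EuclideanSpace ℂ (Fin n))) (z : EuclideanSpace ℂ (Fin n)) : ℝ :=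
  if z ∈ Ω then -Metric.infDist z (frontier Ω) else Metric.infDist z (frontier Ω)

/-- `⟨∂f(p),V⟩ = Σ_k f_{z_k}(p) V_k`, the complex gradient pairing. -/
def dDir {n : ℕ} (f : EuclideanSpace ℂ (Fin n) → ℂ) (p V : EuclideanSpace ℂ (Fin n)) : ℂ :=
  (1/2 : ℂ) * (fderiv ℝ f p V - Complex.I * fderiv ℝ f p (Complex.I • V))

/-- `Σ_k f_{z̄_k}(p) conj (V_k)`, the conjugate gradient pairing. -/
def dbarDir {n : ℕ} (f : EuclideanSpace ℂ (Fin n) → ℂ) (p V : EuclideanSpace ℂ (Fin n)) : ℂ :=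
  (1/2 : ℂ) * (fderiv ℝ f p V + Complex.I * fderiv ℝ f p (Complex.I • V))

/-- Complex Hessian `L_f(p)(V,W) = Σ_{j,k} ∂²f/∂z_j∂z̄_k(p) V_j conj (W_k)`. -/
def cHess {n : ℕ} (f : EuclideanSpace ℂ (Fin n) → ℂ) (p V W : EuclideanSpace ℂ (Fin n)) : ℂ :=
  dDir (fun z => dbarDir f z W) p V

/-- Real Hessian `H_f(p)(V,W) = Σ_{j,k} ∂²f/∂x_j∂x_k(p) V_j W_k` in the underlying
real coordinates of `ℂⁿ ≅ ℝ^{2n}`. -/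
def rHess {n : ℕ} (f : EuclideanSpace ℂ (Fin n) → ℝ) (p V W : EuclideanSpace ℂ (Fin n)) : ℝ :=
  fderiv ℝ (fun z => fderiv ℝ f z W) p V

/-- `Ω ⊂ ℂⁿ` has smooth (`C^∞`) boundary: the signed distance function is smooth on an
open neighborhood of `frontier Ω` and has unit gradient there. -/
def HasSmoothBoundary {n : ℕ} (Ω : Set (EuclideanSpace ℂ (Fin n))) : Prop :=
  ∃ U : Set (EuclideanSpace ℂ (Fin n)), IsOpen U ∧ frontier Ω ⊆ U ∧
    ContDiffOn ℝ (⊤ : ℕ∞) (sdist Ω) U ∧ ∀ z ∈ U, ‖fderiv ℝ (sdist Ω) z‖ = 1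

open Filter Topology

/-- A preconnected set meeting both `t` and its complement meets the frontier of `t`. -/
lemma IsPreconnected.inter_frontier_of_mem {X : Type*} [TopologicalSpace X] {s t : Set X}
    (hs : IsPreconnected s) {a b : X} (ha : a ∈ s) (hat : a ∈ t) (hb : b ∈ s) (hbt : b ∉ t) :
    (s ∩ frontier t).Nonempty := by
  by_contra hempty
  have hdisj : ∀ x ∈ s, x ∈ closure t → x ∈ interior t := fun x hx hxt => by
    by_contra hxi
    exact hempty ⟨x, hx, hxt, hxi⟩
  obtain ⟨x, -, hxi, hxc⟩ := hs (interior t) (closure t)ᶜ isOpen_interior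
    isClosed_closure.isOpen_compl
    (fun x hx => (em (x ∈ closure t)).imp (hdisj x hx) id)
    ⟨a, ha, hdisj a ha (subset_closure hat)⟩
    ⟨b, hb, fun h => hbt (interior_subset (hdisj b hb h))⟩
  exact hxc (interior_subset_closure hxi)

/-- The signed distance is `1`-Lipschitz. -/
lemma sdist_le_add_dist {n : ℕ} (Ω : Set (EuclideanSpace ℂ (Fin n)))
    (a b : EuclideanSpace ℂ (Fin n)) : sdist Ω b ≤ sdist Ω a + dist a b := by
  have hab := infDist_le_infDist_add_dist (s := frontier Ω) (x := a) (y := b)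
  have hba := infDist_le_infDist_add_dist (s := frontier Ω) (x := b) (y := a)
  have ha := infDist_nonneg (s := frontier Ω) (x := a)
  have hb := infDist_nonneg (s := frontier Ω) (x := b)
  rw [dist_comm b a] at hba
  unfold sdist
  split_ifs with h1 h2 h2
  · linarith
  · linarith [dist_nonneg (x := a) (y := b)]
  · obtain ⟨q, hq, hqΩ⟩ := (convex_segment (𝕜 := ℝ) a b).isPreconnected.inter_frontier_of_mem
      (left_mem_segment ℝ a b) h2 (right_mem_segment ℝ a b) h1
    have h3 := infDist_le_dist_of_mem (x := a) hqΩ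
    have h4 := infDist_le_dist_of_mem (x := b) hqΩ
    have h5 := dist_add_dist_of_mem_segment hq
    rw [dist_comm b q] at h4
    linarith
  · linarith

/-- Second-order necessary condition for a local minimum on the line. -/
lemma IsLocalMin.deriv_eq_zero_and_second_nonneg {g g' : ℝ → ℝ} {x a : ℝ} (hmin : IsLocalMin g x)
    (hg : ∀ᶠ t in 𝓝 x, HasDerivAt g (g' t) t) (hg' : HasDerivAt g' a x) :
    g' x = 0 ∧ 0 ≤ a := by
  have h0 : g' x = 0 := hmin.hasDerivAt_eq_zero hg.self_of_nhds
  refine ⟨h0, ?_⟩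
  by_contra! ha
  have hd : deriv g =ᶠ[𝓝 x] g' := hg.mono fun t ht => ht.deriv
  have hdd : deriv (deriv g) x = a := by rw [hd.deriv_eq, hg'.deriv]
  have hmax : IsLocalMax g x := isLocalMax_of_deriv_deriv_neg (by rwa [hdd])
    (by rw [hd.self_of_nhds, h0]) hg.self_of_nhds.continuousAt
  have hconst : g =ᶠ[𝓝 x] fun _ => g x := by
    filter_upwards [hmin, hmax] with t h1 h2 using le_antisymm h2 h1
  have : deriv (deriv g) x = 0 := by
    rw [hconst.deriv.deriv_eq]; simp
  linarith

section SecondOrder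

variable {n : ℕ} {f : EuclideanSpace ℂ (Fin n) → ℝ} {p : EuclideanSpace ℂ (Fin n)}

lemma ContDiffAt.eventually_hasFDerivAt (hf : ContDiffAt ℝ 2 f p) :
    ∀ᶠ x in 𝓝 p, HasFDerivAt f (fderiv ℝ f x) x :=
  (hf.eventually (by simp)).mono fun _ hx => (hx.differentiableAt (by simp)).hasFDerivAt

lemma ContDiffAt.hasFDerivAt_fderiv (hf : ContDiffAt ℝ 2 f p) :
    HasFDerivAt (fderiv ℝ f) (fderiv ℝ (fderiv ℝ f) p) p :=
  ((hf.fderiv_right (m := 1) (by norm_num)).differentiableAt (by simp)).hasFDerivAt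

lemma ContDiffAt.hasFDerivAt_fderiv_apply (hf : ContDiffAt ℝ 2 f p)
    (W : EuclideanSpace ℂ (Fin n)) :
    HasFDerivAt (fun x => fderiv ℝ f x W) (fderiv ℝ (fun x => fderiv ℝ f x W) p) p :=
  (hf.hasFDerivAt_fderiv.differentiableAt.clm_apply
    (differentiableAt_const W)).hasFDerivAt

lemma ContDiffAt.rHess_eq (hf : ContDiffAt ℝ 2 f p) (V W : EuclideanSpace ℂ (Fin n)) :
    rHess f p V W = fderiv ℝ (fderiv ℝ f) p V W := by
  have h := hf.hasFDerivAt_fderiv.clm_apply (hasFDerivAt_const W p)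
  rw [rHess, h.fderiv]
  simp

/-- Second-order chain rule along a curve. -/
lemma ContDiffAt.hasDerivAt_comp_curve {γ γ' : ℝ → EuclideanSpace ℂ (Fin n)} {t₀ : ℝ}
    {w : EuclideanSpace ℂ (Fin n)} (hf : ContDiffAt ℝ 2 f (γ t₀))
    (hγ : ∀ t, HasDerivAt γ (γ' t) t) (hγ' : HasDerivAt γ' w t₀) :
    (∀ᶠ t in 𝓝 t₀, HasDerivAt (fun t => f (γ t)) (fderiv ℝ f (γ t) (γ' t)) t) ∧
      HasDerivAt (fun t => fderiv ℝ f (γ t) (γ' t))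
        (rHess f (γ t₀) (γ' t₀) (γ' t₀) + fderiv ℝ f (γ t₀) w) t₀ := by
  constructor
  · filter_upwards [(hγ t₀).continuousAt.eventually hf.eventually_hasFDerivAt] with t ht
    exact ht.comp_hasDerivAt t (hγ t)
  · rw [hf.rHess_eq]
    exact (hf.hasFDerivAt_fderiv.comp_hasDerivAt t₀ (hγ t₀)).clm_apply hγ'

lemma fderiv_ofReal_comp {x : EuclideanSpace ℂ (Fin n)} (hf : DifferentiableAt ℝ f x)
    (V : EuclideanSpace ℂ (Fin n)) :
    fderiv ℝ (fun w => ((f w : ℝ) : ℂ)) x V = (fderiv ℝ f x V : ℂ) := by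
  have h := (Complex.ofRealCLM.hasFDerivAt (x := f x)).comp x hf.hasFDerivAt
  have h' : HasFDerivAt (fun w => ((f w : ℝ) : ℂ)) (Complex.ofRealCLM.comp (fderiv ℝ f x)) x := h
  rw [h'.fderiv]
  simp

/-- The complex Hessian of a real function on the diagonal, in terms of its real Hessian. -/
lemma ContDiffAt.re_cHess (hf : ContDiffAt ℝ 2 f p) (V : EuclideanSpace ℂ (Fin n)) :
    (cHess (fun w => ((f w : ℝ) : ℂ)) p V V).re =
      (rHess f p V V + rHess f p (Complex.I • V) (Complex.I • V)) / 4 := by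
  have hev : (fun x => dbarDir (fun w => ((f w : ℝ) : ℂ)) x V) =ᶠ[𝓝 p]
      fun x => (1/2 : ℂ) * ((fderiv ℝ f x V : ℝ) + Complex.I * (fderiv ℝ f x (Complex.I • V) : ℝ)) := by
    filter_upwards [hf.eventually_hasFDerivAt] with x hx
    simp only [dbarDir, fderiv_ofReal_comp hx.differentiableAt]
  have h1 := (Complex.ofRealCLM.hasFDerivAt (x := fderiv ℝ f p V)).comp p
    (hf.hasFDerivAt_fderiv_apply V)
  have h2 := (Complex.ofRealCLM.hasFDerivAt (x := fderiv ℝ f p (Complex.I • V))).comp p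
    (hf.hasFDerivAt_fderiv_apply (Complex.I • V))
  have h3 := ((h1.add (h2.const_mul Complex.I)).const_mul (1/2 : ℂ)).congr_of_eventuallyEq hev
  simp only [cHess, dDir, h3.fderiv, rHess]
  simp
  ring

lemma ContDiffAt.rHess_neg_log_neg (hf : ContDiffAt ℝ 2 f p) (hp : f p < 0)
    (V : EuclideanSpace ℂ (Fin n)) :
    rHess (fun x => -Real.log (-(f x))) p V V =
      -(f p)⁻¹ * rHess f p V V + (fderiv ℝ f p V) ^ 2 / (f p) ^ 2 := by
  have hev : (fun x => fderiv ℝ (fun x => -Real.log (-(f x))) x V) =ᶠ[𝓝 p]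
      fun x => -((f x)⁻¹ * fderiv ℝ f x V) := by
    filter_upwards [hf.eventually_hasFDerivAt,
      hf.continuousAt.eventually (gt_mem_nhds hp)] with x hx hx0
    have h : HasFDerivAt (fun x => -Real.log (-(f x))) (-((-(f x))⁻¹ • -fderiv ℝ f x)) x :=
      (hx.fun_neg.log (neg_ne_zero.2 hx0.ne)).fun_neg
    rw [h.fderiv]
    simp [inv_neg]
  have h := ((((hasDerivAt_inv hp.ne).comp_hasFDerivAt p hf.eventually_hasFDerivAt.self_of_nhds).mul
    (hf.hasFDerivAt_fderiv_apply V)).neg).congr_of_eventuallyEq hev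
  rw [rHess, h.fderiv, rHess]
  simp
  field_simp
  ring

end SecondOrder

/-- Let `f` be `1`-Lipschitz with `f p - f z = ‖p - z‖`. Moving `z` along a line and `p` along
`t ↦ z + tV + exp (ct) (p - z)` yields first and second order relations between `f` at `z`
and at `p`. -/
lemma lipschitz_second_variation {n : ℕ} {f : EuclideanSpace ℂ (Fin n) → ℝ}
    {z p : EuclideanSpace ℂ (Fin n)} (hlip : ∀ a b, f b ≤ f a + dist a b)
    (hzp : f p = f z + ‖p - z‖) (hz : ContDiffAt ℝ 2 f z) (hp : ContDiffAt ℝ 2 f p)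
    (V : EuclideanSpace ℂ (Fin n)) (c : ℂ) :
    fderiv ℝ f z V + ‖p - z‖ * c.re - fderiv ℝ f p (V + c • (p - z)) = 0 ∧
      0 ≤ rHess f z V V + ‖p - z‖ * c.re ^ 2 -
        (rHess f p (V + c • (p - z)) (V + c • (p - z)) + fderiv ℝ f p (c ^ 2 • (p - z))) := by
  have hl (t : ℝ) : HasDerivAt (fun t : ℝ => z + t • V) V t := by
    simpa using ((hasDerivAt_id t).smul_const V).const_add z
  have he (t : ℝ) : HasDerivAt (fun t : ℝ => Complex.exp (c * t)) (c * Complex.exp (c * t)) t := by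
    have h := ((Complex.ofRealCLM.hasDerivAt (x := t)).const_mul c).cexp
    simpa [mul_comm] using h
  have hγ (t : ℝ) : HasDerivAt (fun t : ℝ => z + t • V + Complex.exp (c * t) • (p - z))
      (V + (c * Complex.exp (c * t)) • (p - z)) t :=
    (hl t).add ((he t).smul_const (p - z))
  have hγ' : HasDerivAt (fun t : ℝ => V + (c * Complex.exp (c * t)) • (p - z))
      (c ^ 2 • (p - z)) 0 := by
    have h := (((he 0).const_mul c).smul_const (p - z)).const_add V
    simpa [sq] using h
  have hr (t : ℝ) : HasDerivAt (fun t : ℝ => ‖p - z‖ * Real.exp (c.re * t))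
      (‖p - z‖ * (c.re * Real.exp (c.re * t))) t := by
    have h := (((hasDerivAt_id t).const_mul c.re).exp).const_mul ‖p - z‖
    simpa [mul_comm] using h
  have hr' : HasDerivAt (fun t : ℝ => ‖p - z‖ * (c.re * Real.exp (c.re * t)))
      (‖p - z‖ * c.re ^ 2) 0 := by
    have h := (hr 0).const_mul c.re
    refine (h.congr_deriv ?_).congr_of_eventuallyEq (.of_forall fun t => ?_)
    · rw [mul_zero, Real.exp_zero]; ring
    · ring
  obtain ⟨a1, a2⟩ := ContDiffAt.hasDerivAt_comp_curve (f := f) (t₀ := 0) (by simpa using hz) hl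
    (hasDerivAt_const 0 V)
  obtain ⟨b1, b2⟩ := ContDiffAt.hasDerivAt_comp_curve (f := f) (t₀ := 0) (by simpa using hp) hγ hγ'
  have hmin : IsLocalMin (fun t : ℝ => f (z + t • V) + ‖p - z‖ * Real.exp (c.re * t)
      - f (z + t • V + Complex.exp (c * t) • (p - z))) 0 := by
    refine Filter.Eventually.of_forall fun t => ?_
    have h := hlip (z + t • V) (z + t • V + Complex.exp (c * t) • (p - z))
    rw [dist_self_add_right, norm_smul, Complex.norm_exp] at h
    simp at h ⊢
    linarith
  have key := hmin.deriv_eq_zero_and_second_nonneg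
    (by filter_upwards [a1, b1] with t h1 h2 using (h1.add (hr t)).sub h2)
    ((a2.add hr').sub b2)
  simpa using key

/-- A `1`-Lipschitz function growing at maximal rate from `z` to `p` has slope `‖p - z‖` at `p`
in the direction `p - z`. -/
lemma fderiv_apply_sub_of_lipschitz {n : ℕ} {f : EuclideanSpace ℂ (Fin n) → ℝ}
    {z p : EuclideanSpace ℂ (Fin n)} (hlip : ∀ a b, f b ≤ f a + dist a b)
    (hzp : f p = f z + ‖p - z‖) (hp : DifferentiableAt ℝ f p) :
    fderiv ℝ f p (p - z) = ‖p - z‖ := by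
  have hl : HasDerivAt (fun t : ℝ => z + t • (p - z)) (p - z) 1 := by
    simpa using ((hasDerivAt_id (1 : ℝ)).smul_const (p - z)).const_add z
  have hp' : HasFDerivAt f (fderiv ℝ f p) (z + (1 : ℝ) • (p - z)) := by
    simpa using hp.hasFDerivAt
  have h1 := (hp'.comp_hasDerivAt 1 hl).hasDerivWithinAt (s := Icc 0 1)
  have h2 : HasDerivWithinAt (fun t : ℝ => f z + t * ‖p - z‖) ‖p - z‖ (Icc 0 1) 1 := by
    simpa using (((hasDerivAt_id (1 : ℝ)).mul_const ‖p - z‖).const_add (f z)).hasDerivWithinAt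
  have hval : ∀ t ∈ Icc (0 : ℝ) 1, f (z + t • (p - z)) = f z + t * ‖p - z‖ := by
    rintro t ⟨ht0, ht1⟩
    have ha := hlip z (z + t • (p - z))
    have hb := hlip (z + t • (p - z)) p
    have e : z + t • (p - z) - p = -((1 - t) • (p - z)) := by module
    rw [dist_self_add_right, norm_smul, Real.norm_of_nonneg ht0] at ha
    rw [dist_eq_norm, e, norm_neg, norm_smul, Real.norm_of_nonneg (by linarith)] at hb
    linarith
  have h3 := h2.congr (f₁ := f ∘ fun t : ℝ => z + t • (p - z)) hval (hval 1 (by simp))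
  exact (uniqueDiffOn_Icc zero_lt_one 1 (by simp)).eq_deriv _ h1 h3

/-- **Oka's Lemma.** If `Ω ⊂ ℂⁿ` is a bounded domain with smooth boundary which is
pseudoconvex, then `-log(-δ)` is plurisubharmonic on `U ∩ Ω` for some neighborhood `U`
of `bΩ`. -/
theorem oka_lemma {n : ℕ} (Ω : Set (EuclideanSpace ℂ (Fin n)))
    (hopen : IsOpen Ω) (hconn : IsConnected Ω) (hbdd : Bornology.IsBounded Ω)
    (hsmooth : HasSmoothBoundary Ω)
    (hpsc : ∀ p ∈ frontier Ω, ∀ V : EuclideanSpace ℂ (Fin n),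
      dDir (fun w => ((sdist Ω w : ℝ) : ℂ)) p V = 0 → 0 ≤ (cHess (fun w => ((sdist Ω w : ℝ) : ℂ)) p V V).re) :
    ∃ U : Set (EuclideanSpace ℂ (Fin n)), IsOpen U ∧ frontier Ω ⊆ U ∧
      ∀ z ∈ U ∩ Ω, ∀ V : EuclideanSpace ℂ (Fin n),
        0 ≤ (cHess (fun w => ((-Real.log (-(sdist Ω w)) : ℝ) : ℂ)) z V V).re := by
  obtain ⟨U, hU, hFU, hsm, -⟩ := hsmooth
  have hC {x} (hx : x ∈ U) : ContDiffAt ℝ 2 (sdist Ω) x :=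
    (hsm.contDiffAt (hU.mem_nhds hx)).of_le (WithTop.coe_le_coe.2 le_top)
  rcases (frontier Ω).eq_empty_or_nonempty with hemp | hne
  · exact ⟨∅, isOpen_empty, by rw [hemp], by simp⟩
  refine ⟨U, hU, hFU, ?_⟩
  rintro z ⟨hzU, hzΩ⟩ V
  have hcomp : IsCompact (frontier Ω) :=
    Metric.isCompact_of_isClosed_isBounded isClosed_frontier
      (hbdd.closure.subset frontier_subset_closure)
  obtain ⟨p, hpF, hpd⟩ := hcomp.exists_infDist_eq_dist hne z
  have hpΩ : p ∉ Ω := fun h => by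
    rw [hopen.frontier_eq] at hpF
    exact hpF.2 h
  have hδz : sdist Ω z = -‖p - z‖ := by
    rw [sdist, if_pos hzΩ, hpd, dist_eq_norm, norm_sub_rev]
  have hδp : sdist Ω p = 0 := by
    rw [sdist, if_neg hpΩ, infDist_zero_of_mem hpF]
  have hs : 0 < ‖p - z‖ := norm_pos_iff.2 (sub_ne_zero.2 fun h => hpΩ (h ▸ hzΩ))
  have hzp : sdist Ω p = sdist Ω z + ‖p - z‖ := by rw [hδz, hδp]; ring
  have hz := hC hzU
  have hp := hC (hFU hpF)
  have hlip := sdist_le_add_dist Ω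
  have hslope := fderiv_apply_sub_of_lipschitz hlip hzp (hp.differentiableAt (by simp))
  have hz0 : sdist Ω z < 0 := by linarith
  have hφ : ContDiffAt ℝ 2 (fun w => -Real.log (-(sdist Ω w))) z :=
    (hz.neg.log (by simpa using hz0.ne)).neg
  rw [hφ.re_cHess, hz.rHess_neg_log_neg hz0, hz.rHess_neg_log_neg hz0]
  set ℓ := fderiv ℝ (sdist Ω) p with hℓ
  set s := ‖p - z‖
  have hsmul (a : ℂ) (v : EuclideanSpace ℂ (Fin n)) :
      ℓ (a • v) = a.re * ℓ v + a.im * ℓ (Complex.I • v) := by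
    have e : a • v = a.re • v + a.im • (Complex.I • v) := by
      conv_lhs => rw [← Complex.re_add_im a]
      rw [add_smul, mul_smul]
      rfl
    rw [e, map_add, map_smul, map_smul, smul_eq_mul, smul_eq_mul]
  -- choose `c` so that `T = V + c (p - z)` is complex tangential at `p`
  obtain ⟨c, hT, hIT⟩ : ∃ c : ℂ, ℓ (V + c • (p - z)) = 0 ∧
      ℓ (Complex.I • (V + c • (p - z))) = 0 := by
    set β := ℓ (Complex.I • (p - z))
    have hden : ((s : ℂ) - Complex.I * β) ≠ 0 := fun h => by
      have := congrArg Complex.re h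
      simp at this
      exact hs.ne' this
    set c := -((ℓ V : ℂ) - Complex.I * (ℓ (Complex.I • V) : ℝ)) / ((s : ℂ) - Complex.I * β)
    have hcm : c * ((s : ℂ) - Complex.I * β) = -((ℓ V : ℂ) - Complex.I * (ℓ (Complex.I • V) : ℝ)) :=
      div_mul_cancel₀ _ hden
    have hre := congrArg Complex.re hcm
    have him := congrArg Complex.im hcm
    simp at hre him
    refine ⟨c, ?_, ?_⟩
    · rw [map_add, hsmul, hslope]
      linarith
    · rw [smul_add, smul_smul, map_add, hsmul (Complex.I * c), hslope]
      simp
      linarith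
  have hLevi := hpsc p hpF (V + c • (p - z)) (by
    simp only [dDir, fderiv_ofReal_comp (hp.differentiableAt (by simp)), ← hℓ, hT, hIT]
    simp)
  rw [hp.re_cHess] at hLevi
  obtain ⟨e1, q1⟩ := lipschitz_second_variation hlip hzp hz hp V c
  obtain ⟨e2, q2⟩ := lipschitz_second_variation hlip hzp hz hp (Complex.I • V) (Complex.I * c)
  have hIT' : Complex.I • V + (Complex.I * c) • (p - z) = Complex.I • (V + c • (p - z)) := by
    module
  have hsq : (Complex.I * c) ^ 2 • (p - z) = -(c ^ 2 • (p - z)) := by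
    rw [mul_pow, Complex.I_sq, neg_one_mul, neg_smul]
  rw [hIT'] at e2 q2
  rw [hsq, map_neg] at q2
  rw [← hℓ] at e1 e2 q1 q2
  rw [hT] at e1
  rw [hIT] at e2
  simp only [Complex.mul_re, Complex.I_re, Complex.I_im, zero_mul, one_mul, zero_sub] at e2 q2
  have d1 : fderiv ℝ (sdist Ω) z V = -(s * c.re) := by linarith
  have d2 : fderiv ℝ (sdist Ω) z (Complex.I • V) = s * c.im := by linarith
  rw [d1, d2, hδz]
  have hsum : 0 ≤ rHess (sdist Ω) z V V + rHess (sdist Ω) z (Complex.I • V) (Complex.I • V)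
      + s * (c.re ^ 2 + c.im ^ 2) := by nlinarith
  have := div_nonneg hsum hs.le
  have heq : -(-s)⁻¹ * rHess (sdist Ω) z V V + (-(s * c.re)) ^ 2 / (-s) ^ 2 +
      (-(-s)⁻¹ * rHess (sdist Ω) z (Complex.I • V) (Complex.I • V) + (s * c.im) ^ 2 / (-s) ^ 2) =
      (rHess (sdist Ω) z V V + rHess (sdist Ω) z (Complex.I • V) (Complex.I • V)
      + s * (c.re ^ 2 + c.im ^ 2)) / s := by
    field_simp
    ring
  rw [heq]
  positivity
end
end

section
/- Let Ω ⊂ ℂⁿ be a bounded domain with smooth boundary which is ℂ-convex. Then there exists an open neighborhood U of bΩ such that for all z ∈ U ∩ Ω and all V ∈ ℂⁿ, the real Hessian of the signed distance function satisfies H_δ(z)(V,V) ≥ |⟨∇δ(z), iV⟩|² / δ(z) (note δ(z) < 0 on Ω, so the right-hand side is ≤ 0). -/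
noncomputable section

open Complex Metric Set
open scoped Classical RealInnerProductSpace

/-- The second-order necessary condition at a local minimum. -/
theorem IsLocalMin.second_hasDerivAt_nonneg {g g' : ℝ → ℝ} {a c : ℝ} (hmin : IsLocalMin g a)
    (hg : ∀ᶠ t in nhds a, HasDerivAt g (g' t) t) (hg' : HasDerivAt g' c a) : 0 ≤ c := by
  by_contra! hc
  have hd : deriv g =ᶠ[nhds a] g' := hg.mono fun t ht => ht.deriv
  have hdd : deriv (deriv g) a = c := by rw [hd.deriv_eq, hg'.deriv]
  have hmax : IsLocalMax g a :=
    isLocalMax_of_deriv_deriv_neg (by rw [hdd]; exact hc) hmin.deriv_eq_zero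
      hg.self_of_nhds.continuousAt
  have hconst : g =ᶠ[nhds a] fun _ => g a := by
    filter_upwards [hmin, hmax] with t h1 h2 using le_antisymm h2 h1
  have h0 : deriv (deriv g) a = 0 := by
    rw [hconst.deriv.deriv_eq]
    simp
  linarith

/-- A function touching a quadratic polynomial from above at `0` has the same slope there. -/
theorem HasDerivAt.eq_of_quadratic_le {h : ℝ → ℝ} {h' a b : ℝ} (hh : HasDerivAt h h' 0)
    (hle : ∀ t, h 0 + a * t + b * t ^ 2 ≤ h t) : h' = a := by
  have hmin : IsLocalMin (fun t => h t - (h 0 + a * t + b * t ^ 2)) 0 :=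
    Filter.Eventually.of_forall fun t => by
      have := hle t
      simp only
      linarith
  have hp : HasDerivAt (fun t : ℝ => h 0 + a * t + b * t ^ 2) a 0 := by
    have := (((hasDerivAt_id (0 : ℝ)).const_mul a).const_add (h 0)).add
      (((hasDerivAt_id (0 : ℝ)).pow 2).const_mul b)
    exact this.congr_deriv (by simp)
  linarith [hmin.hasDerivAt_eq_zero (hh.sub hp)]

/-- The second derivative at `0` of the norm of an affine line in the complex plane. -/
theorem hasDerivAt_sqrt_quadratic {r a m : ℝ} (hr : 0 < r) :
    ∃ q' : ℝ → ℝ, (∀ᶠ t in nhds (0 : ℝ),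
        HasDerivAt (fun t => √(r ^ 2 - 2 * r * a * t + m * t ^ 2)) (q' t) t) ∧
      HasDerivAt q' ((m - a ^ 2) / r) 0 := by
  have hQ : ∀ t : ℝ, HasDerivAt (fun t => r ^ 2 - 2 * r * a * t + m * t ^ 2)
      (-(2 * r * a) + 2 * m * t) t := fun t => by
    have := (((hasDerivAt_id t).const_mul (2 * r * a)).const_sub (r ^ 2)).add
      (((hasDerivAt_id t).pow 2).const_mul m)
    refine this.congr_deriv ?_
    simp
    ring
  have hpos : ∀ᶠ t in nhds (0 : ℝ), 0 < r ^ 2 - 2 * r * a * t + m * t ^ 2 :=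
    (hQ 0).continuousAt.eventually_const_lt (by simpa using pow_pos hr 2)
  refine ⟨fun t => (-(2 * r * a) + 2 * m * t) / (2 * √(r ^ 2 - 2 * r * a * t + m * t ^ 2)),
    hpos.mono fun t ht => (hQ t).sqrt ht.ne', ?_⟩
  have hs : √(r ^ 2 - 2 * r * a * 0 + m * 0 ^ 2) = r := by
    simp [Real.sqrt_sq hr.le]
  have hden := ((hQ 0).sqrt hpos.self_of_nhds.ne').const_mul 2
  have hnum : HasDerivAt (fun t : ℝ => -(2 * r * a) + 2 * m * t) (2 * m) 0 := by
    simpa using ((hasDerivAt_id (0 : ℝ)).const_mul (2 * m)).const_add (-(2 * r * a))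
  refine (hnum.div hden (by rw [hs]; positivity)).congr_deriv ?_
  rw [hs]
  field_simp
  ring

/-- The norm is bounded by a quadratic polynomial along a line. -/
theorem norm_add_smul_le_quadratic {E : Type*} [NormedAddCommGroup E] [InnerProductSpace ℂ E]
    {u : E} (hu : 0 < ‖u‖) (D : E) (t : ℝ) :
    ‖u + (t : ℂ) • D‖ ≤
      ‖u‖ + (inner ℂ u D).re / ‖u‖ * t + ‖D‖ ^ 2 / (2 * ‖u‖) * t ^ 2 := by
  have hsq : ‖u + (t : ℂ) • D‖ ^ 2 = ‖u‖ ^ 2 + 2 * t * (inner ℂ u D).re + t ^ 2 * ‖D‖ ^ 2 := by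
    rw [norm_add_sq (𝕜 := ℂ), inner_smul_right, norm_smul, mul_pow, Complex.norm_real,
      Real.norm_eq_abs, sq_abs]
    simp
    ring
  have h : ‖u + (t : ℂ) • D‖ ≤ (‖u + (t : ℂ) • D‖ ^ 2 + ‖u‖ ^ 2) / (2 * ‖u‖) := by
    rw [le_div_iff₀ (by positivity)]
    nlinarith [sq_nonneg (‖u + (t : ℂ) • D‖ - ‖u‖)]
  refine h.trans (le_of_eq ?_)
  rw [hsq]
  field_simp
  ring

/-- A preconnected set meeting both a set and its complement meets the frontier. -/
theorem IsPreconnected.inter_frontier_nonempty {X : Type*} [TopologicalSpace X] {s t : Set X}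
    (ht : IsPreconnected t) (hs : (t ∩ s).Nonempty) (hsc : (t ∩ sᶜ).Nonempty) :
    (t ∩ frontier s).Nonempty := by
  by_contra! hempty
  have hnot : ∀ w ∈ t, w ∉ frontier s := fun w hw hf =>
    hempty.subset ⟨hw, hf⟩
  have hint : ∀ w ∈ t, w ∈ closure s → w ∈ interior s := fun w hw hc => by
    by_contra hi
    exact hnot w hw ⟨hc, hi⟩
  obtain ⟨y, hyt, hys⟩ := hs
  obtain ⟨x, hxt, hxs⟩ := hsc
  obtain ⟨w, -, hwi, hwc⟩ := ht (interior s) (closure s)ᶜ isOpen_interior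
    isClosed_closure.isOpen_compl
    (fun w hw => (em (w ∈ closure s)).imp (hint w hw) id)
    ⟨y, hyt, hint y hyt (subset_closure hys)⟩
    ⟨x, hxt, fun hc => hxs (interior_subset (hint x hxt hc))⟩
  exact hwc (interior_subset_closure hwi)

section SignedDistance

variable {n : ℕ}

/-- The signed distance is 1-Lipschitz. -/
theorem sdist_sub_le_dist {Ω : Set (EuclideanSpace ℂ (Fin n))} (x y : EuclideanSpace ℂ (Fin n)) :
    sdist Ω x - sdist Ω y ≤ dist x y := by
  unfold sdist
  by_cases hx : x ∈ Ω <;> by_cases hy : y ∈ Ω <;> simp only [hx, hy, if_true, if_false]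
  · have := infDist_le_infDist_add_dist (s := frontier Ω) (x := y) (y := x)
    rw [dist_comm] at this
    linarith
  · linarith [infDist_nonneg (x := x) (s := frontier Ω), infDist_nonneg (x := y) (s := frontier Ω),
      dist_nonneg (x := x) (y := y)]
  · obtain ⟨q, hq, hqf⟩ := (convex_segment (𝕜 := ℝ) x y).isPreconnected.inter_frontier_nonempty
      ⟨y, right_mem_segment ℝ x y, hy⟩ ⟨x, left_mem_segment ℝ x y, hx⟩
    have h1 := infDist_le_dist_of_mem (x := x) hqf
    have h2 := infDist_le_dist_of_mem (x := y) hqf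
    have h3 := dist_add_dist_of_mem_segment hq
    rw [dist_comm y q] at h2
    linarith
  · linarith [infDist_le_infDist_add_dist (s := frontier Ω) (x := x) (y := y)]

section Line

variable {f : EuclideanSpace ℂ (Fin n) → ℝ} {x V : EuclideanSpace ℂ (Fin n)}

theorem hasDerivAt_add_smul (x V : EuclideanSpace ℂ (Fin n)) (t : ℝ) :
    HasDerivAt (fun t : ℝ => x + (t : ℂ) • V) V t := by
  have := ((hasDerivAt_id t).smul_const V).const_add x
  simpa only [id, one_smul, Complex.coe_smul] using this

theorem hasDerivAt_comp_add_smul (t : ℝ) (hf : DifferentiableAt ℝ f (x + (t : ℂ) • V)) :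
    HasDerivAt (fun t : ℝ => f (x + (t : ℂ) • V)) (fderiv ℝ f (x + (t : ℂ) • V) V) t :=
  hf.hasFDerivAt.comp_hasDerivAt t (hasDerivAt_add_smul x V t)

theorem eventually_hasDerivAt_comp_add_smul (hf : ContDiffAt ℝ 2 f x) :
    ∀ᶠ t : ℝ in nhds 0,
      HasDerivAt (fun t : ℝ => f (x + (t : ℂ) • V)) (fderiv ℝ f (x + (t : ℂ) • V) V) t := by
  have hc : Filter.Tendsto (fun t : ℝ => x + (t : ℂ) • V) (nhds 0) (nhds x) := by
    simpa [ContinuousAt] using (hasDerivAt_add_smul x V 0).continuousAt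
  exact (hc.eventually (hf.eventually (by simp))).mono fun t ht =>
    hasDerivAt_comp_add_smul t (ht.differentiableAt (by simp))

theorem hasDerivAt_fderiv_comp_add_smul (hf : ContDiffAt ℝ 2 f x) :
    HasDerivAt (fun t : ℝ => fderiv ℝ f (x + (t : ℂ) • V) V) (rHess f x V V) 0 := by
  have hd : DifferentiableAt ℝ (fderiv ℝ f) x :=
    (hf.fderiv_right (m := 1) (by norm_num)).differentiableAt (by simp)
  have hd' : DifferentiableAt ℝ (fun w => fderiv ℝ f w V) x := hd.clm_apply (by fun_prop)
  have h0 : x + ((0 : ℝ) : ℂ) • V = x := by simp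
  rw [← h0] at hd'
  have := hd'.hasFDerivAt.comp_hasDerivAt (0 : ℝ) (hasDerivAt_add_smul x V 0)
  rw [h0] at this
  exact this

end Line

/-- The gradients of the signed distance at two points realizing the Lipschitz bound. -/
theorem fderiv_sdist_of_sub_eq_dist {Ω : Set (EuclideanSpace ℂ (Fin n))}
    {z p : EuclideanSpace ℂ (Fin n)} (hzp : sdist Ω p - sdist Ω z = ‖p - z‖) (hr : 0 < ‖p - z‖)
    (hz : DifferentiableAt ℝ (sdist Ω) z) (hp : DifferentiableAt ℝ (sdist Ω) p)
    (V : EuclideanSpace ℂ (Fin n)) :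
    fderiv ℝ (sdist Ω) z V = (inner ℂ (p - z) V).re / ‖p - z‖ ∧
      fderiv ℝ (sdist Ω) p V = (inner ℂ (p - z) V).re / ‖p - z‖ := by
  constructor
  · have hd := hasDerivAt_comp_add_smul (f := sdist Ω) (x := z) (V := V) 0 (by simpa)
    refine (hd.congr_deriv (by simp)).eq_of_quadratic_le (b := -(‖V‖ ^ 2 / (2 * ‖p - z‖)))
      fun t => ?_
    have h1 := sdist_sub_le_dist (Ω := Ω) p (z + (t : ℂ) • V)
    have h2 := norm_add_smul_le_quadratic hr (-V) t
    rw [dist_eq_norm, show p - (z + (t : ℂ) • V) = p - z + (t : ℂ) • -V by module] at h1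
    simp only [inner_neg_right, Complex.neg_re, norm_neg, neg_div] at h2
    simp only [Complex.ofReal_zero, zero_smul, add_zero]
    linarith
  · have hd := hasDerivAt_comp_add_smul (f := sdist Ω) (x := p) (V := V) 0 (by simpa)
    have hd' := (hd.congr_deriv (g' := fderiv ℝ (sdist Ω) p V) (by simp)).neg
    refine neg_injective (hd'.eq_of_quadratic_le (b := -(‖V‖ ^ 2 / (2 * ‖p - z‖)))
      fun t => ?_)
    have h1 := sdist_sub_le_dist (Ω := Ω) (p + (t : ℂ) • V) z
    have h2 := norm_add_smul_le_quadratic hr V t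
    rw [dist_eq_norm, show p + (t : ℂ) • V - z = p - z + (t : ℂ) • V by module] at h1
    simp only [Pi.neg_apply, Complex.ofReal_zero, zero_smul, add_zero]
    linarith

/-- Comparison of Hessians of the signed distance at two points realizing the Lipschitz bound,
along directions that differ by a complex multiple of the segment joining the points. -/
theorem rHess_sdist_add_nonneg {Ω : Set (EuclideanSpace ℂ (Fin n))}
    {z p : EuclideanSpace ℂ (Fin n)} (hzp : sdist Ω p - sdist Ω z = ‖p - z‖) (hr : 0 < ‖p - z‖)
    (hz : ContDiffAt ℝ 2 (sdist Ω) z) (hp : ContDiffAt ℝ 2 (sdist Ω) p)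
    {V W : EuclideanSpace ℂ (Fin n)} {β : ℂ} (hVW : V - W = β • (p - z)) :
    rHess (sdist Ω) p W W - β.im ^ 2 * ‖p - z‖ ≤ rHess (sdist Ω) z V V := by
  set r := ‖p - z‖ with hrdef
  obtain ⟨q', hq, hq'⟩ := hasDerivAt_sqrt_quadratic (a := r * β.re)
    (m := r ^ 2 * (β.re ^ 2 + β.im ^ 2)) hr
  have hmin : IsLocalMin (fun t : ℝ => sdist Ω (z + (t : ℂ) • V) - sdist Ω (p + (t : ℂ) • W) +
      √(r ^ 2 - 2 * r * (r * β.re) * t + r ^ 2 * (β.re ^ 2 + β.im ^ 2) * t ^ 2)) 0 := by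
    refine Filter.Eventually.of_forall fun t => ?_
    have h1 := sdist_sub_le_dist (Ω := Ω) (p + (t : ℂ) • W) (z + (t : ℂ) • V)
    have h2 : p + (t : ℂ) • W - (z + (t : ℂ) • V) = (1 - (t : ℂ) * β) • (p - z) := by
      rw [show p + (t : ℂ) • W - (z + (t : ℂ) • V) = p - z - (t : ℂ) • (V - W) by module, hVW]
      module
    have h3 : ‖p + (t : ℂ) • W - (z + (t : ℂ) • V)‖ =
        √(r ^ 2 - 2 * r * (r * β.re) * t + r ^ 2 * (β.re ^ 2 + β.im ^ 2) * t ^ 2) := by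
      rw [h2, norm_smul, ← hrdef, ← Real.sqrt_sq (by positivity : 0 ≤ ‖1 - (t : ℂ) * β‖ * r),
        mul_pow, Complex.sq_norm, Complex.normSq_apply]
      congr 1
      simp
      ring
    rw [dist_eq_norm, h3] at h1
    simp only [Complex.ofReal_zero, zero_smul, add_zero, mul_zero, sub_zero, ne_eq,
      OfNat.ofNat_ne_zero, not_false_eq_true, zero_pow, Real.sqrt_sq hr.le]
    linarith
  have h := hmin.second_hasDerivAt_nonneg
    (by filter_upwards [eventually_hasDerivAt_comp_add_smul (V := V) hz,
          eventually_hasDerivAt_comp_add_smul (V := W) hp, hq] with t h1 h2 h3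
        exact (h1.sub h2).add h3)
    (((hasDerivAt_fderiv_comp_add_smul (V := V) hz).sub
      (hasDerivAt_fderiv_comp_add_smul (V := W) hp)).add hq')
  have he : (r ^ 2 * (β.re ^ 2 + β.im ^ 2) - (r * β.re) ^ 2) / r = β.im ^ 2 * r := by
    field_simp
    ring
  linarith

end SignedDistance

/-- If `Ω` is a smoothly bounded `ℂ`-convex domain, then near `bΩ` and inside `Ω` the real
Hessian of `δ` satisfies `H_δ(z)(V,V) ≥ |⟨∇δ(z), iV⟩|² / δ(z)`. -/
theorem c_convex_hessian_estimate {n : ℕ} (Ω : Set (EuclideanSpace ℂ (Fin n)))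
    (hopen : IsOpen Ω) (hconn : IsConnected Ω) (hbdd : Bornology.IsBounded Ω)
    (hsmooth : HasSmoothBoundary Ω)
    (hccvx : ∀ p ∈ frontier Ω, ∀ V : EuclideanSpace ℂ (Fin n),
      dDir (fun w => ((sdist Ω w : ℝ) : ℂ)) p V = 0 → 0 ≤ rHess (sdist Ω) p V V) :
    ∃ U : Set (EuclideanSpace ℂ (Fin n)), IsOpen U ∧ frontier Ω ⊆ U ∧
      ∀ z ∈ U ∩ Ω, ∀ V : EuclideanSpace ℂ (Fin n),
        (fderiv ℝ (sdist Ω) z (Complex.I • V)) ^ 2 / sdist Ω z ≤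
          rHess (sdist Ω) z V V := by
  rcases (frontier Ω).eq_empty_or_nonempty with hne | hne
  · exact ⟨∅, isOpen_empty, hne.subset, by simp⟩
  obtain ⟨U, hU, hsub, hC, -⟩ := hsmooth
  refine ⟨U, hU, hsub, fun z hz V => ?_⟩
  obtain ⟨p, hpf, hp⟩ := isClosed_frontier.exists_infDist_eq_dist hne z
  have hpΩ : p ∉ Ω := fun h => hopen.inter_frontier_eq.subset ⟨h, hpf⟩
  have hr : 0 < ‖p - z‖ := norm_pos_iff.2 (sub_ne_zero.2 fun h => hpΩ (h ▸ hz.2))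
  have hδz : sdist Ω z = -‖p - z‖ := by
    rw [sdist, if_pos hz.2, hp, dist_comm, dist_eq_norm]
  have hδp : sdist Ω p = 0 := by
    rw [sdist, if_neg hpΩ, infDist_zero_of_mem hpf]
  have hzp : sdist Ω p - sdist Ω z = ‖p - z‖ := by rw [hδz, hδp]; ring
  have hC2 : ∀ w ∈ U, ContDiffAt ℝ 2 (sdist Ω) w := fun w hw =>
    (hC.contDiffAt (hU.mem_nhds hw)).of_le (WithTop.coe_le_coe.2 le_top)
  have hCz := hC2 z hz.1
  have hCp := hC2 p (hsub hpf)
  have hgrad := fderiv_sdist_of_sub_eq_dist hzp hr (hCz.differentiableAt (by simp))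
    (hCp.differentiableAt (by simp))
  set r := ‖p - z‖ with hrdef
  set β : ℂ := inner ℂ (p - z) V / (r : ℂ) ^ 2 with hβ
  have hr0 : (r : ℂ) ≠ 0 := by exact_mod_cast hr.ne'
  set W := V - β • (p - z) with hW
  have horth : inner ℂ (p - z) W = 0 := by
    rw [hW, inner_sub_right, inner_smul_right, inner_self_eq_norm_sq_to_K, hβ]
    simp only [← hrdef, Complex.coe_algebraMap]
    field_simp
    simp
  have hdDir : dDir (fun w => ((sdist Ω w : ℝ) : ℂ)) p W = 0 := by
    have hd : HasFDerivAt (fun w => ((sdist Ω w : ℝ) : ℂ))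
        (Complex.ofRealCLM.comp (fderiv ℝ (sdist Ω) p)) p :=
      Complex.ofRealCLM.hasFDerivAt.comp p (hCp.differentiableAt (by simp)).hasFDerivAt
    rw [dDir, hd.fderiv]
    simp [(hgrad _).2, horth]
  have hle := rHess_sdist_add_nonneg hzp hr hCz hCp (V := V) (W := W) (β := β) (by rw [hW]; abel)
  refine le_trans (le_of_eq ?_) ((sub_le_sub_right (hccvx p hpf W hdDir) _).trans hle)
  have him : β.im = (inner ℂ (p - z) V).im / r ^ 2 := by
    rw [hβ, ← Complex.ofReal_pow, Complex.div_ofReal_im]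
  rw [(hgrad _).1, hδz, him, inner_smul_right, Complex.I_mul_re, ← hrdef]
  field_simp
  ring
end
end

section
/- Let Ω ⊂ ℂⁿ be a bounded domain with smooth boundary which is ℂ-convex, and let D(z) = dist(z, bΩ)². Then there exists an open neighborhood U of bΩ such that for all z ∈ U ∩ Ω and all V ∈ ℂⁿ, H_D(z)(V,V) ≤ |⟨∇D(z),V⟩|²/(2 D(z)) + |⟨∇D(z), iV⟩|²/(2 D(z)). -/
noncomputable section

open Complex Metric Set
open scoped Classical RealInnerProductSpace

lemma second_derivative_test {G G' : ℝ → ℝ} {c : ℝ} (hG : ∀ t, 0 ≤ G t) (h0 : G 0 = 0)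
    (h1 : ∀ᶠ t in nhds 0, HasDerivAt G (G' t) t) (h2 : HasDerivAt G' c 0) :
    G' 0 = 0 ∧ 0 ≤ c := by
  have hmin : IsLocalMin G 0 := Filter.Eventually.of_forall fun t => by rw [h0]; exact hG t
  have hG'0 : G' 0 = 0 := hmin.hasDerivAt_eq_zero h1.self_of_nhds
  refine ⟨hG'0, ?_⟩
  by_contra! hc
  have hd : deriv G =ᶠ[nhds 0] G' := h1.mono fun t ht => ht.deriv
  have hdd : deriv (deriv G) 0 = c := by rw [hd.deriv_eq, h2.deriv]
  have hmax : IsLocalMax G 0 :=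
    isLocalMax_of_deriv_deriv_neg (by rw [hdd]; exact hc)
      (by rw [hd.self_of_nhds, hG'0]) h1.self_of_nhds.continuousAt
  have hz : G =ᶠ[nhds 0] fun _ => 0 := hmax.mono fun t ht => le_antisymm (by rwa [h0] at ht) (hG t)
  have hdz : deriv G =ᶠ[nhds 0] fun _ => 0 := by
    simpa using hz.deriv
  rw [hdz.deriv_eq, deriv_const] at hdd
  exact hc.ne hdd.symm

lemma norm_add_real_smul_sq {n : ℕ} (u e : EuclideanSpace ℂ (Fin n)) (t : ℝ) :
    ‖u + t • e‖ ^ 2 = ‖u‖ ^ 2 + 2 * t * (inner ℂ u e).re + t ^ 2 * ‖e‖ ^ 2 := by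
  have h : t • e = (t : ℂ) • e := by ext i; simp
  rw [h, norm_add_sq (𝕜 := ℂ), inner_smul_right, norm_smul]
  simp [mul_pow]
  ring

lemma infDist_add_infDist_frontier_le {n : ℕ} {Ω : Set (EuclideanSpace ℂ (Fin n))}
    {w y : EuclideanSpace ℂ (Fin n)} (hw : w ∈ Ω) (hy : y ∉ Ω) :
    infDist w (frontier Ω) + infDist y (frontier Ω) ≤ dist w y := by
  obtain ⟨q, hq, hqf⟩ : (segment ℝ w y ∩ frontier Ω).Nonempty := by
    by_contra hemp
    have hcov : segment ℝ w y ⊆ interior Ω ∪ (closure Ω)ᶜ := fun q hq => by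
      by_contra hq'
      rw [mem_union, not_or, notMem_compl_iff] at hq'
      exact hemp ⟨q, hq, hq'.2, hq'.1⟩
    have hw' : w ∈ interior Ω := (hcov (left_mem_segment ℝ w y)).resolve_right
      fun h => h (subset_closure hw)
    have hy' : y ∈ (closure Ω)ᶜ := (hcov (right_mem_segment ℝ w y)).resolve_left
      fun h => hy (interior_subset h)
    obtain ⟨q, -, hq1, hq2⟩ := (convex_segment w y).isPreconnected _ _ isOpen_interior
      isClosed_closure.isOpen_compl hcov ⟨w, left_mem_segment ℝ w y, hw'⟩
      ⟨y, right_mem_segment ℝ w y, hy'⟩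
    exact hq2 (subset_closure (interior_subset hq1))
  rw [← dist_add_dist_of_mem_segment hq, dist_comm q y]
  exact add_le_add (infDist_le_dist_of_mem hqf) (infDist_le_dist_of_mem hqf)

lemma abs_sdist_sub_le {n : ℕ} (Ω : Set (EuclideanSpace ℂ (Fin n)))
    (w y : EuclideanSpace ℂ (Fin n)) : |sdist Ω w - sdist Ω y| ≤ dist w y := by
  have hL := (lipschitz_infDist_pt (frontier Ω)).dist_le_mul w y
  rw [Real.dist_eq, NNReal.coe_one, one_mul] at hL
  have hnw : 0 ≤ infDist w (frontier Ω) := infDist_nonneg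
  have hny : 0 ≤ infDist y (frontier Ω) := infDist_nonneg
  unfold sdist
  rw [abs_le] at hL ⊢
  split_ifs with h1 h2 h2
  · constructor <;> linarith
  · have := infDist_add_infDist_frontier_le h1 h2
    constructor <;> linarith
  · have := infDist_add_infDist_frontier_le h2 h1
    rw [dist_comm] at this
    constructor <;> linarith
  · exact hL

lemma sdist_sq {n : ℕ} (Ω : Set (EuclideanSpace ℂ (Fin n))) (w : EuclideanSpace ℂ (Fin n)) :
    infDist w (frontier Ω) ^ 2 = sdist Ω w ^ 2 := by
  unfold sdist; split_ifs <;> ring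

lemma sdist_eq_zero_of_mem_frontier {n : ℕ} {Ω : Set (EuclideanSpace ℂ (Fin n))}
    {p : EuclideanSpace ℂ (Fin n)} (hp : p ∈ frontier Ω) : sdist Ω p = 0 := by
  simp [sdist, infDist_zero_of_mem hp]

lemma hasDerivAt_fderiv_line {n : ℕ} {f : EuclideanSpace ℂ (Fin n) → ℝ}
    {z : EuclideanSpace ℂ (Fin n)} (hf : ContDiffAt ℝ 2 f z) (V : EuclideanSpace ℂ (Fin n)) :
    (∀ᶠ t : ℝ in nhds 0, HasDerivAt (fun t : ℝ => f (z + t • V)) (fderiv ℝ f (z + t • V) V) t) ∧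
      HasDerivAt (fun t : ℝ => fderiv ℝ f (z + t • V) V) (rHess f z V V) 0 := by
  have hline : ∀ t : ℝ, HasDerivAt (fun t : ℝ => z + t • V) V t := fun t => by
    simpa using ((hasDerivAt_id t).smul_const V).const_add z
  have hz : z + (0 : ℝ) • V = z := by simp
  constructor
  · have hev : ∀ᶠ w in nhds (z + (0 : ℝ) • V), DifferentiableAt ℝ f w := by
      rw [hz]
      exact (hf.eventually (by simp)).mono fun w hw => hw.differentiableAt (by simp)
    exact ((hline 0).continuousAt.eventually hev).mono fun t ht =>
      ht.hasFDerivAt.comp_hasDerivAt t (hline t)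
  · have hd : DifferentiableAt ℝ (fun w => fderiv ℝ f w V) (z + (0 : ℝ) • V) := by
      rw [hz]
      exact ((hf.fderiv_right (m := 1) (by norm_num)).differentiableAt (by simp)).clm_apply
        (differentiableAt_const V)
    have := hd.hasFDerivAt.comp_hasDerivAt (0 : ℝ) (hline 0)
    rw [hz] at this
    exact this

/-- First- and second-order information carried by the Lipschitz estimate for the signed distance
along the lines `z + tV` and `p + tx`, where `p` is a boundary point closest to `z`. -/
lemma sdist_variation {n : ℕ} {Ω : Set (EuclideanSpace ℂ (Fin n))}
    {z p : EuclideanSpace ℂ (Fin n)} (hz : ContDiffAt ℝ 2 (sdist Ω) z)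
    (hp : ContDiffAt ℝ 2 (sdist Ω) p) (hp0 : sdist Ω p = 0) (hz0 : sdist Ω z = -‖z - p‖)
    (V x : EuclideanSpace ℂ (Fin n)) :
    (inner ℂ (z - p) (V - x)).re =
        ‖z - p‖ * (fderiv ℝ (sdist Ω) p x - fderiv ℝ (sdist Ω) z V) ∧
      (fderiv ℝ (sdist Ω) p x - fderiv ℝ (sdist Ω) z V) ^ 2 +
          ‖z - p‖ * (rHess (sdist Ω) p x x - rHess (sdist Ω) z V V) ≤ ‖V - x‖ ^ 2 := by
  obtain ⟨hz1, hz2⟩ := hasDerivAt_fderiv_line hz V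
  obtain ⟨hp1, hp2⟩ := hasDerivAt_fderiv_line hp x
  set δ := sdist Ω
  set r := ‖z - p‖
  set a := (inner ℂ (z - p) (V - x)).re
  set e := ‖V - x‖ ^ 2
  set φ : ℝ → ℝ := fun t => δ (p + t • x) - δ (z + t • V)
  set φ' : ℝ → ℝ := fun t => fderiv ℝ δ (p + t • x) x - fderiv ℝ δ (z + t • V) V
  have hφ : ∀ᶠ t in nhds 0, HasDerivAt φ (φ' t) t := by
    filter_upwards [hz1, hp1] with t h1 h2 using h2.sub h1
  have hφ' : HasDerivAt φ' (rHess δ p x x - rHess δ z V V) 0 := hp2.sub hz2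
  have hφ0 : φ 0 = r := by simp [φ, hp0, hz0]
  have hφ'0 : φ' 0 = fderiv ℝ δ p x - fderiv ℝ δ z V := by simp [φ']
  have key := second_derivative_test
    (G := fun t => r ^ 2 + 2 * t * a + t ^ 2 * e - φ t ^ 2)
    (G' := fun t => 2 * a + 2 * t * e - 2 * (φ t * φ' t))
    (c := 2 * e - 2 * (φ' 0 * φ' 0 + φ 0 * (rHess δ p x x - rHess δ z V V)))
    (fun t => by
      have h := abs_sdist_sub_le Ω (p + t • x) (z + t • V)
      have h2 : dist (p + t • x) (z + t • V) = ‖(z - p) + t • (V - x)‖ := by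
        rw [dist_comm, dist_eq_norm]; congr 1; rw [smul_sub]; abel
      rw [h2] at h
      have h3 := pow_le_pow_left₀ (abs_nonneg _) h 2
      rw [sq_abs, norm_add_real_smul_sq] at h3
      exact sub_nonneg.mpr h3)
    (by simp [hφ0])
    (by
      filter_upwards [hφ] with t ht
      have h1 : HasDerivAt (fun t : ℝ => r ^ 2 + 2 * t * a + t ^ 2 * e) (2 * a + 2 * t * e) t := by
        have := ((((hasDerivAt_id t).const_mul 2).mul_const a).const_add (r ^ 2)).add
          (((hasDerivAt_id t).pow 2).mul_const e)
        exact this.congr_deriv (by simp)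
      exact (h1.sub (ht.pow 2)).congr_deriv (by simp; ring))
    (by
      have h1 : HasDerivAt (fun t : ℝ => 2 * a + 2 * t * e) (2 * e) 0 := by
        simpa using (((hasDerivAt_id (0 : ℝ)).const_mul 2).mul_const e).const_add (2 * a)
      exact h1.sub ((hφ.self_of_nhds.mul hφ').const_mul 2))
  simp only [hφ0, hφ'0] at key
  constructor
  · linarith [key.1]
  · nlinarith [key.2]

lemma dDir_ofReal {n : ℕ} {f : EuclideanSpace ℂ (Fin n) → ℝ} {p : EuclideanSpace ℂ (Fin n)}
    (hf : DifferentiableAt ℝ f p) (x : EuclideanSpace ℂ (Fin n)) :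
    dDir (fun w => ((f w : ℝ) : ℂ)) p x =
      (1 / 2 : ℂ) * ((fderiv ℝ f p x : ℝ) - Complex.I * (fderiv ℝ f p (Complex.I • x) : ℝ)) := by
  have h : HasFDerivAt (fun w => ((f w : ℝ) : ℂ)) (Complex.ofRealCLM.comp (fderiv ℝ f p)) p :=
    Complex.ofRealCLM.hasFDerivAt.comp p hf.hasFDerivAt
  simp [dDir, h.fderiv]

lemma fderiv_and_rHess_sq {n : ℕ} {f : EuclideanSpace ℂ (Fin n) → ℝ}
    {z : EuclideanSpace ℂ (Fin n)} (hf : ContDiffAt ℝ 2 f z) (V : EuclideanSpace ℂ (Fin n)) :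
    fderiv ℝ (fun w => f w ^ 2) z V = 2 * f z * fderiv ℝ f z V ∧
      rHess (fun w => f w ^ 2) z V V = 2 * fderiv ℝ f z V ^ 2 + 2 * f z * rHess f z V V := by
  have hev : (fun w => fderiv ℝ (fun w => f w ^ 2) w V) =ᶠ[nhds z]
      fun w => 2 * f w * fderiv ℝ f w V := by
    filter_upwards [hf.eventually (by simp)] with w hw
    rw [((hw.differentiableAt (by simp)).hasFDerivAt.pow 2).fderiv]
    simp
  refine ⟨hev.self_of_nhds, ?_⟩
  have h1 := (hf.differentiableAt (by simp)).hasFDerivAt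
  have h2 : DifferentiableAt ℝ (fun w => fderiv ℝ f w V) z :=
    ((hf.fderiv_right (m := 1) (by norm_num)).differentiableAt (by simp)).clm_apply
      (differentiableAt_const V)
  unfold rHess
  have h3 : HasFDerivAt (fun w => 2 * f w * fderiv ℝ f w V) _ z :=
    (h1.const_mul 2).mul h2.hasFDerivAt
  rw [hev.fderiv_eq, h3.fderiv]
  simp
  ring

/-- Lower bound for the Hessian of the signed distance at an interior point `z` in terms of
positivity of the Hessian on the complex tangent space at a closest boundary point `p`. -/
lemma neg_sdist_mul_rHess_le {n : ℕ} {Ω : Set (EuclideanSpace ℂ (Fin n))}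
    {z p : EuclideanSpace ℂ (Fin n)} (hz : ContDiffAt ℝ 2 (sdist Ω) z)
    (hp : ContDiffAt ℝ 2 (sdist Ω) p) (hp0 : sdist Ω p = 0) (hz0 : sdist Ω z = -‖z - p‖)
    (hzp : z ≠ p)
    (hpos : ∀ x : EuclideanSpace ℂ (Fin n),
      dDir (fun w => ((sdist Ω w : ℝ) : ℂ)) p x = 0 → 0 ≤ rHess (sdist Ω) p x x)
    (V : EuclideanSpace ℂ (Fin n)) :
    sdist Ω z * rHess (sdist Ω) z V V ≤ fderiv ℝ (sdist Ω) z (Complex.I • V) ^ 2 := by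
  have hr : 0 < ‖z - p‖ := norm_pos_iff.mpr (sub_ne_zero.mpr hzp)
  set r := ‖z - p‖ with hr_def
  set ν : EuclideanSpace ℂ (Fin n) := ((r⁻¹ : ℝ) : ℂ) • (p - z) with hν
  have hνn : ‖ν‖ = 1 := by
    rw [hν, norm_smul, norm_sub_rev p z, ← hr_def]
    simp [abs_of_pos hr, hr.ne']
  have hinner : ∀ y, (inner ℂ ν y).re = r⁻¹ * -(inner ℂ (z - p) y).re := fun y => by
    rw [hν, inner_smul_left, ← neg_sub z p, inner_neg_left, conj_ofReal, re_ofReal_mul, neg_re]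
  have hdz : ∀ y, fderiv ℝ (sdist Ω) z y = (inner ℂ ν y).re := fun y => by
    have h := (sdist_variation hz hp hp0 hz0 y 0).1
    simp only [sub_zero, map_zero, zero_sub, ← hr_def] at h
    rw [hinner, h]
    field_simp
  have hdp : ∀ y, fderiv ℝ (sdist Ω) p y = (inner ℂ ν y).re := fun y => by
    have h := (sdist_variation hz hp hp0 hz0 0 y).1
    simp only [zero_sub, map_zero, sub_zero, inner_neg_right, neg_re, ← hr_def] at h
    rw [hinner, h]
    field_simp
  set c := inner ℂ ν V with hc
  set x := V - c • ν with hx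
  have hνx : inner ℂ ν x = 0 := by
    rw [hx, inner_sub_right, inner_smul_right, inner_self_eq_norm_sq_to_K, hνn, ← hc]
    simp
  have hxpos := hpos x (by
    rw [dDir_ofReal (hp.differentiableAt (by simp)), hdp, hdp, inner_smul_right, hνx]
    simp)
  have h := (sdist_variation hz hp hp0 hz0 V x).2
  have he : ‖V - x‖ ^ 2 = c.re ^ 2 + c.im ^ 2 := by
    rw [hx, sub_sub_cancel, norm_smul, hνn, mul_one, Complex.sq_norm, Complex.normSq_apply]
    ring
  rw [he, hdp, hνx, hdz, ← hc, ← hr_def] at h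
  rw [hdz, inner_smul_right, ← hc, hz0]
  simp only [Complex.zero_re, Complex.mul_re, Complex.I_re, Complex.I_im] at h ⊢
  nlinarith [mul_nonneg hr.le hxpos]

/-- If `Ω` is a smoothly bounded `ℂ`-convex domain and `D = dist(·, bΩ)²`, then near `bΩ`
and inside `Ω`: `H_D(z)(V,V) ≤ |⟨∇D(z),V⟩|²/(2D(z)) + |⟨∇D(z),iV⟩|²/(2D(z))`. -/
theorem squared_distance_estimate_c_convex {n : ℕ} (Ω : Set (EuclideanSpace ℂ (Fin n)))
    (hopen : IsOpen Ω) (hconn : IsConnected Ω) (hbdd : Bornology.IsBounded Ω)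
    (hsmooth : HasSmoothBoundary Ω)
    (hccvx : ∀ p ∈ frontier Ω, ∀ V : EuclideanSpace ℂ (Fin n),
      dDir (fun w => ((sdist Ω w : ℝ) : ℂ)) p V = 0 → 0 ≤ rHess (sdist Ω) p V V) :
    ∃ U : Set (EuclideanSpace ℂ (Fin n)), IsOpen U ∧ frontier Ω ⊆ U ∧
      ∀ z ∈ U ∩ Ω, ∀ V : EuclideanSpace ℂ (Fin n),
        rHess (fun w => Metric.infDist w (frontier Ω) ^ 2) z V V ≤
          (fderiv ℝ (fun w => Metric.infDist w (frontier Ω) ^ 2) z V) ^ 2 / (2 * Metric.infDist z (frontier Ω) ^ 2) +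
          (fderiv ℝ (fun w => Metric.infDist w (frontier Ω) ^ 2) z (Complex.I • V)) ^ 2 /
            (2 * Metric.infDist z (frontier Ω) ^ 2) := by
  obtain ⟨U, hU, hfU, hsm, -⟩ := hsmooth
  rcases (frontier Ω).eq_empty_or_nonempty with hemp | hne
  · exact ⟨∅, isOpen_empty, hemp.subset, fun z hz => absurd hz.1 (notMem_empty z)⟩
  refine ⟨U, hU, hfU, fun z hz V => ?_⟩
  have hC : ∀ w ∈ U, ContDiffAt ℝ 2 (sdist Ω) w := fun w hw =>
    (hsm.contDiffAt (hU.mem_nhds hw)).of_le (WithTop.coe_le_coe.mpr le_top)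
  obtain ⟨p, hpf, hpd⟩ := isClosed_frontier.exists_infDist_eq_dist hne z
  have hzp : z ≠ p := by
    rintro rfl
    exact disjoint_left.mp (disjoint_frontier_iff_isOpen.mpr hopen) hpf hz.2
  have hz0 : sdist Ω z = -‖z - p‖ := by
    rw [sdist, if_pos hz.2, hpd, dist_eq_norm]
  have hne0 : sdist Ω z ≠ 0 := by
    rw [hz0, neg_ne_zero, norm_ne_zero_iff]
    exact sub_ne_zero.mpr hzp
  have key := neg_sdist_mul_rHess_le (hC z hz.1) (hC p (hfU hpf))
    (sdist_eq_zero_of_mem_frontier hpf) hz0 hzp (hccvx p hpf) V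
  simp only [sdist_sq]
  rw [(fderiv_and_rHess_sq (hC z hz.1) V).1, (fderiv_and_rHess_sq (hC z hz.1) V).2,
    (fderiv_and_rHess_sq (hC z hz.1) (Complex.I • V)).1]
  have hdiv : ∀ b : ℝ, (2 * sdist Ω z * b) ^ 2 / (2 * sdist Ω z ^ 2) = 2 * b ^ 2 := fun b => by
    field_simp
  rw [hdiv, hdiv]
  linarith
end
end
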